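/- Hyperbolic-cosine identities across the interface: assume the Rankine–Hugoniot relation holds, π_I > 0, π_II > 0, and W_I ≠ Z. Then both identities hold: (π_II + p_I − p_II) cosh(W_I − Z) = π_II cosh(W_II − W_I) cosh(W_II − Z), and (π_I − p_I + p_II) cosh(W_II − Z) = π_I cosh(W_II − W_I) cosh(W_I − Z). -/

import Mathlib

open Real

/-- Squared Euclidean norm of a vector. -/
noncomputable def nsq {n : ℕ} (w : Fin n → ℝ) : ℝ := ∑ j, (w j) ^ 2

/-- Minkowski bilinear form on `ℝ^{d+1}`: `η(x,y) = -x₀y₀ + ∑_{j=1}^d xⱼyⱼ`. -/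
noncomputable def eta {d : ℕ} (x y : Fin (d + 1) → ℝ) : ℝ :=
  -(x 0 * y 0) + ∑ j : Fin d, x j.succ * y j.succ

/-- Unit spacelike normal `V = (sinh Z, cosh Z, 0, …, 0)` to the interface. -/
noncomputable def normalV (d : ℕ) (Z : ℝ) : Fin (d + 1) → ℝ := fun i =>
  if i.val = 0 then Real.sinh Z else if i.val = 1 then Real.cosh Z else 0

/-- Unit timelike fluid velocity determined by the perpendicular rapidity `W` and
the parallel velocity `w ∈ ℝ^{d-1}`. -/
noncomputable def vel (d : ℕ) (W : ℝ) (w : Fin (d - 1) → ℝ) : Fin (d + 1) → ℝ := fun i =>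
  if i.val = 0 then Real.sqrt (1 + nsq w) * Real.cosh W
  else if i.val = 1 then Real.sqrt (1 + nsq w) * Real.sinh W
  else if h : i.val - 2 < d - 1 then w ⟨i.val - 2, h⟩ else 0

/-- The Rankine–Hugoniot relation
`(μ_II + p_II) η(u_II,V) u_II − (μ_I + p_I) η(u_I,V) u_I + (p_II − p_I) V = 0`. -/
def RH (d : ℕ) (μI pI μII pII : ℝ) (uI uII V : Fin (d + 1) → ℝ) : Prop :=
  ∀ i, (μII + pII) * eta uII V * uII i - (μI + pI) * eta uI V * uI i + (pII - pI) * V i = 0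

theorem nsq_nonneg {n : ℕ} (w : Fin n → ℝ) : 0 ≤ nsq w :=
  Finset.sum_nonneg fun _ _ => sq_nonneg _

/-- The normal component of the fluid velocity depends only on the relative rapidity. -/
theorem eta_vel_normalV {d : ℕ} (hd : 1 ≤ d) (W Z : ℝ) (w : Fin (d - 1) → ℝ) :
    eta (vel d W w) (normalV d Z) = √(1 + nsq w) * sinh (W - Z) := by
  obtain ⟨k, rfl⟩ := Nat.exists_eq_add_of_le' hd
  simp only [eta, Fin.sum_univ_succ]
  simp [vel, normalV, sinh_sub]
  ring

/-- The interface-frame form of the momentum flux balance implies the cosine identity for the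
phase with parameter `Q`. -/
theorem cosh_identity_of_flux_balance {P Q D a b : ℝ}
    (htime : Q * sinh b * cosh b = P * sinh a * cosh a)
    (hspace : Q * sinh b ^ 2 - P * sinh a ^ 2 + D = 0) :
    (Q - D) * cosh a = Q * cosh (b - a) * cosh b := by
  rw [cosh_sub]
  linear_combination sinh a * htime - cosh a * hspace - Q * cosh a * cosh_sq b

/-- Hyperbolic-cosine identities across the interface. -/
theorem cosh_identities (d : ℕ) (hd : 2 ≤ d) (Z μI μII pI pII WI WII : ℝ)
    (wI wII : Fin (d - 1) → ℝ) (hμI : 0 ≤ μI) (hμII : 0 ≤ μII)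
    (hπI : 0 < (μI + pI) * (1 + nsq wI)) (hπII : 0 < (μII + pII) * (1 + nsq wII))
    (hW : WI ≠ Z)
    (hRH : RH d μI pI μII pII (vel d WI wI) (vel d WII wII) (normalV d Z)) :
    ((μII + pII) * (1 + nsq wII) + pI - pII) * Real.cosh (WI - Z)
        = ((μII + pII) * (1 + nsq wII)) * Real.cosh (WII - WI) * Real.cosh (WII - Z)
      ∧ ((μI + pI) * (1 + nsq wI) - pI + pII) * Real.cosh (WII - Z)
        = ((μI + pI) * (1 + nsq wI)) * Real.cosh (WII - WI) * Real.cosh (WI - Z) := by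
  have sqrt_sq (w : Fin (d - 1) → ℝ) : √(1 + nsq w) ^ 2 = 1 + nsq w :=
    sq_sqrt (by linarith [nsq_nonneg w])
  have h0 := hRH 0
  have h1 := hRH ⟨1, by omega⟩
  rw [eta_vel_normalV (by omega), eta_vel_normalV (by omega)] at h0 h1
  simp only [vel, normalV, Fin.val_zero, one_ne_zero, if_true, if_false] at h0 h1
  rw [← sqrt_sq wI, ← sqrt_sq wII]
  set rI := √(1 + nsq wI)
  set rII := √(1 + nsq wII)
  have htime : (μII + pII) * rII ^ 2 * sinh (WII - Z) * cosh (WII - Z)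
      = (μI + pI) * rI ^ 2 * sinh (WI - Z) * cosh (WI - Z) := by
    rw [cosh_sub WII, cosh_sub WI]
    linear_combination cosh Z * h0 - sinh Z * h1
  have hspace : (μII + pII) * rII ^ 2 * sinh (WII - Z) ^ 2
      - (μI + pI) * rI ^ 2 * sinh (WI - Z) ^ 2 + (pII - pI) = 0 := by
    rw [sq (sinh (WII - Z)), sq (sinh (WI - Z))]
    nth_rewrite 2 [sinh_sub WII]
    nth_rewrite 2 [sinh_sub WI]
    linear_combination cosh Z * h1 - sinh Z * h0 - (pII - pI) * cosh_sq Z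
  have hII := cosh_identity_of_flux_balance htime hspace
  have hI := cosh_identity_of_flux_balance (D := pI - pII) htime.symm
    (by linear_combination -hspace)
  rw [show WI - Z - (WII - Z) = -(WII - WI) by ring, cosh_neg] at hI
  rw [show WII - Z - (WI - Z) = WII - WI by ring] at hII
  exact ⟨by linear_combination hII, by linear_combination hI⟩
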